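/- Let q be a probability density on ℝ whose Fourier transform q* never vanishes. For every positive integer m and every x ∈ ℝ, the series ∑_{j∈ℤ} |v_{φ_{m,j}}(x)|² converges and equals Δ(m) = (1/2π)∫_{−πm}^{πm} |q*(u)|^{−2} du; in particular sup_x ∑_{j∈ℤ} |v_{φ_{m,j}}(x)|² = Δ(m). -/

import Mathlib

open MeasureTheory

/-- The cardinal sine `φ(x) = sin(πx)/(πx)` (with `φ(0) = 1`). -/
noncomputable def sinc (x : ℝ) : ℝ :=
  if x = 0 then 1 else Real.sin (Real.pi * x) / (Real.pi * x)

/-- `φ_{m,j}(x) = √m · φ(mx − j)`. -/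
noncomputable def phimj (m : ℕ) (j : ℤ) (x : ℝ) : ℝ :=
  Real.sqrt m * sinc (m * x - j)

/-- Fourier transform `t*(u) = ∫ e^{-ixu} t(x) dx` of a real-valued function on `ℝ`. -/
noncomputable def ft1 (t : ℝ → ℝ) (u : ℝ) : ℂ :=
  ∫ x : ℝ, Complex.exp (-(Complex.I * x * u)) * t x

/-- `Δ(m) = (1/2π) ∫_{−πm}^{πm} |q*(u)|⁻² du`. -/
noncomputable def Delta (q : ℝ → ℝ) (m : ℕ) : ℝ :=
  (2 * Real.pi)⁻¹ *
    ∫ u in Set.Icc (-(Real.pi * m)) (Real.pi * m), (‖ft1 q u‖ ^ 2)⁻¹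

open scoped FourierTransform SchwartzMap ContDiff in
theorem ft_inj (d : ℝ → ℂ) (hd : Integrable d)
    (h : ∀ x : ℝ, ∫ u : ℝ, Complex.exp (Complex.I * x * u) * d u = 0) : ∀ᵐ u, d u = 0 := by
  have hF : ∀ w, 𝓕 d w = 0 := by
    intro w
    rw [Real.fourier_eq' , ← h (-(2 * Real.pi * w))]
    congr 1
    ext v
    rw [smul_eq_mul]
    congr 2
    simp
    ring
  apply ae_eq_zero_of_integral_contDiff_smul_eq_zero hd.locallyIntegrable
  intro g hg hgs
  have hg' : ContDiff ℝ ∞ (fun x => (g x : ℂ)) := Complex.ofRealCLM.contDiff.comp hg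
  have hgs' : HasCompactSupport (fun x => (g x : ℂ)) := hgs.comp_left (g := fun x : ℝ => (x : ℂ)) rfl
  let G : 𝓢(ℝ, ℂ) := hgs'.toSchwartzMap hg'
  have hG : 𝓕 ((𝓕⁻ G : 𝓢(ℝ, ℂ)) : ℝ → ℂ) = fun x => (g x : ℂ) := by
    rw [← SchwartzMap.fourier_coe, FourierTransform.fourier_fourierInv_eq]
    rfl
  have key := VectorFourier.integral_fourierIntegral_smul_eq_flip (L := innerₗ ℝ)
      Real.continuous_fourierChar continuous_inner ((𝓕⁻ G : 𝓢(ℝ, ℂ)).integrable (μ := volume)) hd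
  have : ∫ x, 𝓕 ((𝓕⁻ G : 𝓢(ℝ, ℂ)) : ℝ → ℂ) x • d x
      = ∫ x, ((𝓕⁻ G : 𝓢(ℝ, ℂ)) : ℝ → ℂ) x • 𝓕 d x := by
    simpa using! key
  rw [hG] at this
  simpa [hF] using this

theorem ft1_cont (q : ℝ → ℝ) (hq : Integrable q) : Continuous (ft1 q) := by
  unfold ft1
  refine continuous_of_dominated (bound := fun x => ‖q x‖) ?_ ?_ hq.norm ?_
  · intro u
    refine AEStronglyMeasurable.mul ?_ ?_
    · exact Continuous.aestronglyMeasurable (by fun_prop)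
    · exact hq.ofReal.aestronglyMeasurable
  · intro u
    refine Filter.Eventually.of_forall fun x => ?_
    rw [norm_mul, Complex.norm_exp]
    simp
  · refine Filter.Eventually.of_forall fun x => ?_
    fun_prop

/-- the explicit Fourier transform of `phimj m j` -/
noncomputable def psi0 (m : ℕ) (j : ℤ) : ℝ → ℂ :=
  Set.indicator (Set.Ioc (-(Real.pi * m)) (Real.pi * m))
    (fun u => ((Real.sqrt m : ℝ) : ℂ)⁻¹ * Complex.exp (-(Complex.I * u * j / m)))

theorem psi0_integrable (m : ℕ) (j : ℤ) : Integrable (psi0 m j) := by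
  unfold psi0
  rw [integrable_indicator_iff measurableSet_Ioc]
  apply IntegrableOn.mono_set _ Set.Ioc_subset_Icc_self
  apply Continuous.integrableOn_Icc
  fun_prop

theorem mul_psi0_integral (m : ℕ) (j : ℤ) (F : ℝ → ℂ) :
    ∫ u : ℝ, F u * psi0 m j u = ((Real.sqrt m : ℝ) : ℂ)⁻¹ *
      ∫ u in (-(Real.pi * m))..(Real.pi * m), Complex.exp (-(Complex.I * u * j / m)) * F u := by
  have hle : -(Real.pi * m) ≤ Real.pi * m := by
    have : 0 ≤ Real.pi * m := by positivity
    linarith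
  rw [intervalIntegral.integral_of_le hle, ← integral_const_mul,
    ← integral_indicator measurableSet_Ioc]
  congr 1
  ext u
  unfold psi0
  by_cases hu : u ∈ Set.Ioc (-(Real.pi * m)) (Real.pi * m)
  · rw [Set.indicator_of_mem hu, Set.indicator_of_mem hu]
    ring
  · rw [Set.indicator_of_notMem hu, Set.indicator_of_notMem hu]
    ring

theorem psi0_inv (m : ℕ) (hm : 0 < m) (j : ℤ) (x : ℝ) : (phimj m j x : ℂ)
        = ((2 * Real.pi : ℝ) : ℂ)⁻¹ * ∫ u : ℝ, Complex.exp (Complex.I * x * u) * psi0 m j u := by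
  rw [mul_psi0_integral]
  have hmR : (0 : ℝ) < m := by exact_mod_cast hm
  have hmC : (m : ℂ) ≠ 0 := by exact_mod_cast hm.ne'
  have hpi : (Real.pi : ℂ) ≠ 0 := by exact_mod_cast Real.pi_ne_zero
  have hs : ((Real.sqrt m : ℝ) : ℂ) ≠ 0 := by exact_mod_cast (Real.sqrt_pos.2 hmR).ne'
  have hss : ((Real.sqrt m : ℝ) : ℂ) ^ 2 = m := by
    rw [← Complex.ofReal_pow, Real.sq_sqrt hmR.le]; simp
  have h1 : ∀ u : ℝ, Complex.exp (-(Complex.I * u * j / m)) * Complex.exp (Complex.I * x * u)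
      = Complex.exp ((Complex.I * ((m * x - j) / m : ℂ)) * u) := by
    intro u
    rw [← Complex.exp_add]
    congr 1
    field_simp
    ring
  simp_rw [h1]
  unfold phimj sinc
  by_cases h : (m : ℝ) * x - j = 0
  · have h' : (m : ℂ) * x - j = 0 := by exact_mod_cast h
    rw [if_pos h]
    simp only [h']
    simp
    field_simp
    rw [hss]
    ring
  · have h' : (m : ℂ) * x - j ≠ 0 := by exact_mod_cast h
    rw [if_neg h, integral_exp_mul_complex (by simp [h', hmC, Complex.I_ne_zero])]
    push_cast
    rw [Complex.sin]
    have e1 : Complex.I * ((m * x - j) / m : ℂ) * (Real.pi * m)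
      = Real.pi * (m * x - j) * Complex.I := by field_simp
    have e2 : Complex.I * ((m * x - j) / m : ℂ) * (-(Real.pi * m))
      = -(Real.pi * (m * x - j)) * Complex.I := by field_simp
    rw [e1, e2]
    generalize Complex.exp (Real.pi * (m * x - j) * Complex.I) = A
    generalize Complex.exp (-(Real.pi * (m * x - j)) * Complex.I) = B
    field_simp
    rw [hss, Complex.I_sq]
    ring

/-- The Fourier transform `φ_{m,j}*` is encoded as an integrable function `ψ j` whose inverse
Fourier transform is `φ_{m,j}`; `v_{φ_{m,j}}` is the inverse Fourier transform of
`φ_{m,j}*/q*(−·)`; then `∑_{j∈ℤ} |v_{φ_{m,j}}(x)|²` converges and equals `Δ(m)` for every `x`. -/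
theorem stmt6 (q : ℝ → ℝ) (hq0 : ∀ x, 0 ≤ q x) (hqint : Integrable q)
    (hq1 : ∫ x : ℝ, q x = 1) (hqne : ∀ u, ft1 q u ≠ 0)
    (m : ℕ) (hm : 0 < m)
    (ψ : ℤ → ℝ → ℂ) (hψint : ∀ j, Integrable (ψ j))
    (hψ : ∀ (j : ℤ) (x : ℝ), (phimj m j x : ℂ)
        = ((2 * Real.pi : ℝ) : ℂ)⁻¹ * ∫ u : ℝ, Complex.exp (Complex.I * x * u) * ψ j u)
    (x : ℝ) :
    HasSum
      (fun j : ℤ =>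
        ‖((2 * Real.pi : ℝ) : ℂ)⁻¹ *
            ∫ u : ℝ, Complex.exp (Complex.I * x * u) * (ψ j u / ft1 q (-u))‖ ^ 2)
      (Delta q m) := by
  have hmR : (0 : ℝ) < m := by exact_mod_cast hm
  have hmC : (m : ℂ) ≠ 0 := by exact_mod_cast hm.ne'
  have hpiC : (Real.pi : ℂ) ≠ 0 := by exact_mod_cast Real.pi_ne_zero
  have hpm : 0 < Real.pi * m := by positivity
  have hab : -(Real.pi * m) < Real.pi * m := by linarith
  have hs : 0 < Real.sqrt m := Real.sqrt_pos.2 hmR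
  have hsC : ((Real.sqrt m : ℝ) : ℂ) ≠ 0 := by exact_mod_cast hs.ne'
  have hss : ((Real.sqrt m : ℝ) : ℂ) ^ 2 = m := by
    rw [← Complex.ofReal_pow, Real.sq_sqrt hmR.le]; simp
  have hexp : ∀ (y : ℝ) (f : ℝ → ℂ), Integrable f →
      Integrable (fun u : ℝ => Complex.exp (Complex.I * y * u) * f u) := by
    intro y f hf
    refine hf.bdd_mul (c := 1) (Continuous.aestronglyMeasurable (by fun_prop)) ?_
    refine Filter.Eventually.of_forall fun u => ?_
    rw [Complex.norm_exp]
    simp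
  have hae : ∀ j, ∀ᵐ u, ψ j u = psi0 m j u := by
    intro j
    have := ft_inj (fun u => ψ j u - psi0 m j u) ((hψint j).sub (psi0_integrable m j)) (by
      intro y
      simp_rw [mul_sub]
      rw [integral_sub (hexp y _ (hψint j)) (hexp y _ (psi0_integrable m j)), sub_eq_zero]
      have h2 := (hψ j y).symm.trans (psi0_inv m hm j y)
      refine mul_left_cancel₀ ?_ h2
      simp [hpiC])
    filter_upwards [this] with u hu
    exact sub_eq_zero.1 hu
  set G : ℝ → ℂ := fun u => Complex.exp (Complex.I * x * u) / ft1 q (-u) with hG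
  have hGc : Continuous G := by
    refine Continuous.div (by fun_prop) ((ft1_cont q hqint).comp continuous_neg) fun u => hqne _
  have hL2 : MemLp G 2 (volume.restrict (Set.Ioc (-(Real.pi * m)) (Real.pi * m))) := by
    obtain ⟨C, hC⟩ := (isCompact_Icc (a := -(Real.pi * m)) (b := Real.pi * m)).exists_bound_of_continuousOn
      hGc.continuousOn
    refine MemLp.of_bound hGc.aestronglyMeasurable C ?_
    filter_upwards [ae_restrict_mem measurableSet_Ioc] with u hu
    exact hC u (Set.Ioc_subset_Icc_self hu)
  have hP := (hasSum_sq_fourierCoeffOn hab hL2).mul_left (m : ℝ)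
  have hfun : ∀ j : ℤ, ‖((2 * Real.pi : ℝ) : ℂ)⁻¹ *
      ∫ u : ℝ, Complex.exp (Complex.I * x * u) * (ψ j u / ft1 q (-u))‖ ^ 2
      = (m : ℝ) * ‖fourierCoeffOn hab G j‖ ^ 2 := by
    intro j
    have e : ∫ u : ℝ, Complex.exp (Complex.I * x * u) * (ψ j u / ft1 q (-u))
        = ∫ u : ℝ, G u * psi0 m j u := by
      apply integral_congr_ae
      filter_upwards [hae j] with u hu
      rw [hu, hG]
      ring
    rw [e, mul_psi0_integral, fourierCoeffOn_eq_integral]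
    have e2 : ∀ u : ℝ, fourier (-j) (u : AddCircle (Real.pi * m - -(Real.pi * m))) • G u
        = Complex.exp (-(Complex.I * u * j / m)) * G u := by
      intro u
      rw [fourier_coe_apply, smul_eq_mul]
      congr 2
      push_cast
      field_simp
      ring
    simp_rw [e2]
    generalize (∫ u in (-(Real.pi * m))..(Real.pi * m),
      Complex.exp (-(Complex.I * u * j / m)) * G u) = A
    have e3 : ((2 * Real.pi : ℝ) : ℂ)⁻¹ * (((Real.sqrt m : ℝ) : ℂ)⁻¹ * A)
        = ((Real.sqrt m : ℝ) : ℂ) * ((1 / (Real.pi * m - -(Real.pi * m)) : ℝ) • A) := by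
      rw [Complex.real_smul]
      push_cast
      field_simp
      rw [hss]
      ring
    rw [e3, norm_mul, mul_pow, Complex.norm_real, Real.norm_of_nonneg hs.le, Real.sq_sqrt hmR.le]
  have hval : Delta q m = (m : ℝ) * ((Real.pi * m - -(Real.pi * m))⁻¹ •
      ∫ u in (-(Real.pi * m))..(Real.pi * m), ‖G u‖ ^ 2) := by
    unfold Delta
    have e4 : ∀ u : ℝ, ‖G u‖ ^ 2 = (fun v => (‖ft1 q v‖ ^ 2)⁻¹) (-u) := by
      intro u
      simp only [hG]
      rw [norm_div, Complex.norm_exp]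
      simp
    simp_rw [e4]
    rw [intervalIntegral.integral_comp_neg (fun v => (‖ft1 q v‖ ^ 2)⁻¹), neg_neg,
      intervalIntegral.integral_of_le hab.le, integral_Icc_eq_integral_Ioc, smul_eq_mul,
      ← mul_assoc]
    congr 1
    field_simp
    ring
  rw [hval, funext hfun]
  exact hP
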